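/- Let T be a type equipped with a binary operation ⇒ : T → T → T. Let Tm : (T → Type) → T → Type be the inductive family of intrinsically typed lambda terms: var : Γ τ → Tm Γ τ; app : Tm Γ (s ⇒ t) → Tm Γ s → Tm Γ t; abs : Tm (Γ ,, s) t → Tm Γ (s ⇒ t), where (Γ ,, s) is the context sending u : T to Γ u ⊕ (s = u). Define simultaneous typed substitution subst : Tm Γ τ → (∀ u, Γ u → Tm Δ u) → Tm Δ τ recursively, extending a substitution σ to (Γ ,, s) by sending the new variable to itself and the old variables to the renaming (weakening) of σ along the context inclusion. Then (Tm, var, subst) satisfies the monad laws: subst (var x) σ = σ τ x; subst t (fun u => var) = t; and subst (subst t σ) ρ = subst t (fun u x => subst (σ u x) ρ). -/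

import Mathlib

/-- The extension `Γ ,, s` of a context `Γ : T → Type` by a fresh variable of type `s`:
it sends `u : T` to `Γ u ⊕ (s = u)`. -/
def extCtx {T : Type} (Γ : T → Type) (s : T) : T → Type :=
  fun u => Γ u ⊕ PLift (s = u)

/-- Intrinsically typed lambda terms over a type `T` of simple types equipped with a binary
operation `arrow`: variables, application `Tm Γ (s ⇒ t) → Tm Γ s → Tm Γ t`, and abstraction
`Tm (Γ ,, s) t → Tm Γ (s ⇒ t)`. -/
inductive Tm {T : Type} (arrow : T → T → T) : (T → Type) → T → Type 1
  | var {Γ : T → Type} {τ : T} : Γ τ → Tm arrow Γ τ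
  | app {Γ : T → Type} {s t : T} : Tm arrow Γ (arrow s t) → Tm arrow Γ s → Tm arrow Γ t
  | abs {Γ : T → Type} {s t : T} : Tm arrow (extCtx Γ s) t → Tm arrow Γ (arrow s t)

namespace Tm

variable {T : Type} {arrow : T → T → T}

/-- Renaming along a family of functions `f : ∀ u, Γ u → Δ u`, defined recursively and
commuting with all constructors (extending `f` over the bound variable in `abs`). -/
def rename : {Γ Δ : T → Type} → (∀ u, Γ u → Δ u) → {τ : T} →
    Tm arrow Γ τ → Tm arrow Δ τ
  | _, _, f, _, .var x => .var (f _ x)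
  | _, _, f, _, .app s t => .app (rename f s) (rename f t)
  | _, _, f, _, .abs t => .abs (rename (fun _ => Sum.map (f _) id) t)

/-- Extension of a substitution `σ : ∀ u, Γ u → Tm Δ u` to the contexts extended by a fresh
variable of type `s`: the new variable is sent to itself, and the old variables to the
renaming (weakening) of `σ` along the context inclusion. -/
def extSubst {Γ Δ : T → Type} (σ : ∀ u, Γ u → Tm arrow Δ u) (s : T) :
    ∀ u, extCtx Γ s u → Tm arrow (extCtx Δ s) u
  | _, Sum.inl x => rename (fun _ => Sum.inl) (σ _ x)
  | _, Sum.inr h => .var (Sum.inr h)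

/-- Simultaneous typed substitution, defined recursively. -/
def subst : {Γ Δ : T → Type} → {τ : T} → Tm arrow Γ τ →
    (∀ u, Γ u → Tm arrow Δ u) → Tm arrow Δ τ
  | _, _, _, .var x, σ => σ _ x
  | _, _, _, .app s t, σ => .app (subst s σ) (subst t σ)
  | _, _, _, .abs t, σ => .abs (subst t (extSubst σ _))

end Tm

namespace Tm

variable {T : Type} {arrow : T → T → T}

/-- Extension of a renaming to the contexts extended by a fresh variable of type `s`. -/
def extRename {Γ Δ : T → Type} (f : ∀ u, Γ u → Δ u) (s : T) :
    ∀ u, extCtx Γ s u → extCtx Δ s u :=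
  fun u => Sum.map (f u) id

theorem rename_abs {Γ Δ : T → Type} (f : ∀ u, Γ u → Δ u) {s t : T}
    (a : Tm arrow (extCtx Γ s) t) :
    rename f (.abs a) = .abs (rename (extRename f s) a) := by
  rw [rename]
  rfl

theorem extSubst_var {Γ : T → Type} (s : T) :
    extSubst (fun u => (Tm.var : Γ u → Tm arrow Γ u)) s = fun _ => Tm.var := by
  funext u x
  rcases x with x | h
  · simp only [extSubst, rename]
    rfl
  · simp only [extSubst]

theorem subst_var {Γ : T → Type} {τ : T} (t : Tm arrow Γ τ) :
    subst t (fun _ => Tm.var) = t := by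
  induction t with
  | var x => rw [subst]
  | app a b iha ihb => rw [subst, iha, ihb]
  | abs a ih => rw [subst, extSubst_var, ih]

theorem rename_rename {Γ Δ E : T → Type} {τ : T} (t : Tm arrow Γ τ)
    (f : ∀ u, Γ u → Δ u) (g : ∀ u, Δ u → E u) :
    rename g (rename f t) = rename (fun u x => g u (f u x)) t := by
  induction t generalizing Δ E with
  | var x => simp only [rename]
  | app a b iha ihb => simp only [rename, iha, ihb]
  | abs a ih =>
    rw [rename_abs, rename_abs, rename_abs, ih]
    congr 2
    funext u x
    rcases x with x | h <;> rfl

theorem subst_rename {Γ Δ E : T → Type} {τ : T} (t : Tm arrow Γ τ)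
    (f : ∀ u, Γ u → Δ u) (σ : ∀ u, Δ u → Tm arrow E u) :
    subst (rename f t) σ = subst t (fun u x => σ u (f u x)) := by
  induction t generalizing Δ E with
  | var x => simp only [rename, subst]
  | app a b iha ihb => simp only [rename, subst, iha, ihb]
  | abs a ih =>
    rw [rename_abs, subst, subst, ih]
    congr 2
    funext u x
    rcases x with x | h <;> rfl

theorem rename_extSubst {Γ Δ E : T → Type} (σ : ∀ u, Γ u → Tm arrow Δ u)
    (f : ∀ u, Δ u → E u) (s : T) :
    (fun u x => rename (extRename f s) (extSubst σ s u x)) =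
      extSubst (fun u x => rename f (σ u x)) s := by
  funext u x
  rcases x with x | h
  · exact (rename_rename (σ u x) _ _).trans
      (rename_rename (σ u x) f (E := extCtx E s) (fun _ => Sum.inl)).symm
  · simp only [extSubst, rename]
    rfl

theorem rename_subst {Γ Δ E : T → Type} {τ : T} (t : Tm arrow Γ τ)
    (σ : ∀ u, Γ u → Tm arrow Δ u) (f : ∀ u, Δ u → E u) :
    rename f (subst t σ) = subst t (fun u x => rename f (σ u x)) := by
  induction t generalizing Δ E with
  | var x => simp only [subst]
  | app a b iha ihb => simp only [rename, subst, iha, ihb]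
  | abs a ih => rw [subst, subst, rename_abs, ih, rename_extSubst]

theorem subst_extSubst {Γ Δ E : T → Type} (σ : ∀ u, Γ u → Tm arrow Δ u)
    (ρ : ∀ u, Δ u → Tm arrow E u) (s : T) :
    (fun u x => subst (extSubst σ s u x) (extSubst ρ s)) =
      extSubst (fun u x => subst (σ u x) ρ) s := by
  funext u x
  rcases x with x | h
  · exact (subst_rename (σ u x) _ _).trans
      (rename_subst (σ u x) ρ (E := extCtx E s) (fun _ => Sum.inl)).symm
  · simp only [extSubst, subst]

theorem subst_subst {Γ Δ E : T → Type} {τ : T} (t : Tm arrow Γ τ)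
    (σ : ∀ u, Γ u → Tm arrow Δ u) (ρ : ∀ u, Δ u → Tm arrow E u) :
    subst (subst t σ) ρ = subst t (fun u x => subst (σ u x) ρ) := by
  induction t generalizing Δ E with
  | var x => simp only [subst]
  | app a b iha ihb => simp only [subst, iha, ihb]
  | abs a ih => rw [subst, subst, subst, ih, subst_extSubst]

end Tm

/-- `(Tm, var, subst)` satisfies the monad laws: substitution in a variable gives the value
of the substitution, substitution of variables is the identity, and substitution is
associative. -/
theorem Tm_monad_laws {T : Type} (arrow : T → T → T) :
    (∀ (Γ Δ : T → Type) (τ : T) (x : Γ τ) (σ : ∀ u, Γ u → Tm arrow Δ u),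
      Tm.subst (Tm.var x) σ = σ τ x) ∧
    (∀ (Γ : T → Type) (τ : T) (t : Tm arrow Γ τ),
      Tm.subst t (fun _ => Tm.var) = t) ∧
    (∀ (Γ Δ E : T → Type) (τ : T) (t : Tm arrow Γ τ)
      (σ : ∀ u, Γ u → Tm arrow Δ u) (ρ : ∀ u, Δ u → Tm arrow E u),
      Tm.subst (Tm.subst t σ) ρ = Tm.subst t (fun u x => Tm.subst (σ u x) ρ)) := by
  refine ⟨fun _ _ _ _ _ => ?_, fun _ _ t => Tm.subst_var t,
    fun _ _ _ _ t σ ρ => Tm.subst_subst t σ ρ⟩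
  rw [Tm.subst]
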